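/- arXiv:1102.3818 — 3 statements merged into one kernel-verified Lean document; each statement's English description precedes it below -/
import Mathlib

section
/- Let n ≥ 1 and let k ≥ 0 be an even integer. The kernel function G_k : ℝ^{n+1}∖{0} → Cl_n defined by G_k(x) = conj(x)/‖x‖^{n+1−k}, where x = x_0 + x_1e_1 + ⋯ + x_ne_n is a nonzero paravector and conj(x) = x_0 − x_1e_1 − ⋯ − x_ne_n, satisfies D Δ^{k/2} G_k = 0 on ℝ^{n+1}∖{0}; i.e. G_k is k-holomorphic Cliffordian. -/
noncomputable section

open scoped symmDiff

/-- An explicit model of the real Clifford algebra `Cl_n` with generators `e 0, …, e (n-1)`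
satisfying `eᵢ eⱼ + eⱼ eᵢ = -2 δᵢⱼ` (the Clifford algebra of the negative definite
quadratic form on `ℝⁿ`): elements are coordinate functions on the canonical basis
`(e_A)_{A ⊆ {0,…,n-1}}`, where `e_A` is the (increasingly ordered) product of the `e i`, `i ∈ A`. -/
def Cl (n : ℕ) : Type := Finset (Fin n) → ℝ

namespace Cl

variable {n : ℕ}

instance : NormedAddCommGroup (Cl n) :=
  inferInstanceAs (NormedAddCommGroup (Finset (Fin n) → ℝ))

instance : NormedSpace ℝ (Cl n) :=
  inferInstanceAs (NormedSpace ℝ (Finset (Fin n) → ℝ))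

/-- The coefficient of `a` at the basis element `e_A`. -/
def coeff (a : Cl n) (A : Finset (Fin n)) : ℝ := a A

/-- The sign occurring in the product `e_A * e_B = mulSign A B • e_{A ∆ B}`,
coming from the relations `eᵢ eⱼ = -eⱼ eᵢ` (i ≠ j) and `eᵢ² = -1`. -/
def mulSign (A B : Finset (Fin n)) : ℝ :=
  (-1 : ℝ) ^ (((A ×ˢ B).filter fun p => p.2 < p.1).card + (A ∩ B).card)

/-- Clifford multiplication. -/
def mul (a b : Cl n) : Cl n := fun C =>
  ∑ A : Finset (Fin n), ∑ B : Finset (Fin n),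
    if A ∆ B = C then mulSign A B * a A * b B else 0

/-- The unit `1` of the Clifford algebra. -/
def one : Cl n := Pi.single ∅ 1

/-- The embedding of the real scalars. -/
def scalar (r : ℝ) : Cl n := Pi.single ∅ r

/-- The generators `e i` (in the paper: `e_1, …, e_n`). -/
def e (i : Fin n) : Cl n := Pi.single {i} 1

/-- Reversion: the anti-automorphism fixing all the `e i`. -/
def reverse (a : Cl n) : Cl n := fun A => (-1 : ℝ) ^ (A.card * (A.card - 1) / 2) * a A

/-- The main involution `′`: the automorphism with `(e i)′ = - e i`. -/
def involute (a : Cl n) : Cl n := fun A => (-1 : ℝ) ^ A.card * a A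

/-- Clifford conjugation: the anti-automorphism with `conj (e i) = - e i`
(the composite of reversion and the main involution). -/
def conj (a : Cl n) : Cl n := fun A => (-1 : ℝ) ^ (A.card * (A.card + 1) / 2) * a A

/-- The norm on `Cl n`: the square root of the sum of the squares of the
coordinates in the standard basis. -/
def norm (a : Cl n) : ℝ := Real.sqrt (∑ A : Finset (Fin n), a A ^ 2)

/-- Invertibility in the Clifford algebra. -/
def IsInvertible (a : Cl n) : Prop := ∃ b, mul a b = one ∧ mul b a = one

/-- The inverse of an invertible Clifford number (junk value `0` otherwise). -/
def inv (a : Cl n) : Cl n :=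
  letI := Classical.propDecidable (IsInvertible a)
  if h : IsInvertible a then h.choose else 0

/-- The paravector `x₀ + x₁ e₁ + ⋯ + xₙ eₙ` attached to `x ∈ ℝ^{n+1}`. -/
def para (x : Fin (n + 1) → ℝ) : Cl n :=
  scalar (x 0) + ∑ i : Fin n, x i.succ • e i

/-- Being a paravector. -/
def IsParavector (a : Cl n) : Prop := ∃ x : Fin (n + 1) → ℝ, a = para x

/-- The coordinates in `ℝ^{n+1}` of (the paravector part of) a Clifford number. -/
def paraCoord (a : Cl n) : Fin (n + 1) → ℝ :=
  Fin.cases (coeff a ∅) (fun i => coeff a {i})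

/-- Being a (possibly empty) product of nonzero paravectors. -/
def IsProdOfParavectors (a : Cl n) : Prop :=
  ∃ l : List (Fin (n + 1) → ℝ), (∀ x ∈ l, x ≠ 0) ∧
    a = l.foldr (fun x b => mul (para x) b) one

/-- The special Ahlfors–Vahlen group `SAV(ℝ ⊕ ℝⁿ)`: 2×2 matrices `(a b; c d)` with entries
in `Cl n` such that each entry is `0` or a product of nonzero paravectors,
`a ⬝ reverse d - b ⬝ reverse c = 1`, and `a c⁻¹, c⁻¹ d` are paravectors if `c ≠ 0`
resp. `b d⁻¹` is a paravector if `c = 0`. -/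
structure SAV (n : ℕ) where
  a : Cl n
  b : Cl n
  c : Cl n
  d : Cl n
  prod_a : a = 0 ∨ IsProdOfParavectors a
  prod_b : b = 0 ∨ IsProdOfParavectors b
  prod_c : c = 0 ∨ IsProdOfParavectors c
  prod_d : d = 0 ∨ IsProdOfParavectors d
  det : mul a (reverse d) - mul b (reverse c) = one
  cond_c : c ≠ 0 → IsParavector (mul a (inv c)) ∧ IsParavector (mul (inv c) d)
  cond_c0 : c = 0 → IsParavector (mul b (inv d))

/-- The Clifford number `c x + d` attached to a matrix `M` and `x ∈ ℝ^{n+1}`. -/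
def cxd (M : SAV n) (x : Fin (n + 1) → ℝ) : Cl n := mul M.c (para x) + M.d

/-- The numerator `a x + b`. -/
def axb (M : SAV n) (x : Fin (n + 1) → ℝ) : Cl n := mul M.a (para x) + M.b

/-- The Möbius transformation `M<x> = (ax+b)(cx+d)⁻¹` as a Clifford number. -/
def moebiusCl (M : SAV n) (x : Fin (n + 1) → ℝ) : Cl n := mul (axb M x) (inv (cxd M x))

/-- The Möbius transformation `M<x>` as a point of `ℝ^{n+1}`. -/
def moebius (M : SAV n) (x : Fin (n + 1) → ℝ) : Fin (n + 1) → ℝ :=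
  paraCoord (moebiusCl M x)

/-- `a` lies in the subalgebra `Cl_{n-1}` generated by the `e j` with `j ≠ i`. -/
def memSub (a : Cl n) (i : Fin n) : Prop := ∀ A : Finset (Fin n), i ∈ A → coeff a A = 0

/-- The subgroup `SAV(ℝ ⊕ ℝ^{m})` of `SAV(ℝ ⊕ ℝ^{m+1})` of matrices whose entries lie
in the subalgebra `Cl_m ⊆ Cl_{m+1}`. -/
structure SAVsub (m : ℕ) extends SAV (m + 1) where
  sub_a : memSub a (Fin.last m)
  sub_b : memSub b (Fin.last m)
  sub_c : memSub c (Fin.last m)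
  sub_d : memSub d (Fin.last m)

/-- The `P`-part of `a ∈ Cl_{m+1} = Cl_m ⊕ Cl_m e_{top}`: `a = P a + (Q a) e_top`. -/
def Ppart {m : ℕ} (a : Cl (m + 1)) : Cl (m + 1) := fun A =>
  if Fin.last m ∈ A then 0 else a A

/-- The `Q`-part of `a ∈ Cl_{m+1} = Cl_m ⊕ Cl_m e_{top}`: `a = P a + (Q a) e_top`. -/
def Qpart {m : ℕ} (a : Cl (m + 1)) : Cl (m + 1) := fun A =>
  if Fin.last m ∈ A then 0 else a (insert (Fin.last m) A)

/-- Partial derivative `∂f/∂xᵢ`. -/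
def pderiv {E : Type*} [NormedAddCommGroup E] [NormedSpace ℝ E] {m : ℕ}
    (i : Fin m) (f : (Fin m → ℝ) → E) (x : Fin m → ℝ) : E :=
  fderiv ℝ f x (Pi.single i 1)

/-- The Euclidean Laplacian `Δ = Σᵢ ∂²/∂xᵢ²` (acting componentwise). -/
def lap {E : Type*} [NormedAddCommGroup E] [NormedSpace ℝ E] {m : ℕ}
    (f : (Fin m → ℝ) → E) : (Fin m → ℝ) → E :=
  fun x => ∑ i : Fin m, pderiv i (pderiv i f) x

/-- The Euclidean Dirac operator `D f = ∂f/∂x₀ + Σᵢ eᵢ ∂f/∂xᵢ`. -/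
def dirac (f : (Fin (n + 1) → ℝ) → Cl n) : (Fin (n + 1) → ℝ) → Cl n :=
  fun x => pderiv 0 f x + ∑ i : Fin n, mul (e i) (pderiv i.succ f x)

/-- Upper half-space `H⁺ = {x ∈ ℝ^{n+1} : xₙ > 0}`. -/
def upperHalf (n : ℕ) : Set (Fin (n + 1) → ℝ) := {x | 0 < x (Fin.last n)}

/-- The Euclidean norm on `ℝ^m`. -/
def enorm {m : ℕ} (x : Fin m → ℝ) : ℝ := Real.sqrt (∑ i, x i ^ 2)

end Cl

namespace Cl

section Calculus

variable {E : Type*} [NormedAddCommGroup E] [NormedSpace ℝ E] {m : ℕ}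

lemma pderiv_eq_of_hasFDerivAt {f : (Fin m → ℝ) → E} {f' : (Fin m → ℝ) →L[ℝ] E}
    {x : Fin m → ℝ} (h : HasFDerivAt f f' x) (i : Fin m) :
    pderiv i f x = f' (Pi.single i 1) := by
  rw [pderiv, h.fderiv]

lemma pderiv_eventuallyEq {f g : (Fin m → ℝ) → E} {x : Fin m → ℝ}
    (h : f =ᶠ[nhds x] g) (i : Fin m) : pderiv i f =ᶠ[nhds x] pderiv i g :=
  h.fderiv.mono fun y hy => by rw [pderiv, hy, pderiv]

lemma lap_eq_of_eventuallyEq {f g : (Fin m → ℝ) → E} {x : Fin m → ℝ}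
    (h : f =ᶠ[nhds x] g) : lap f x = lap g x :=
  Finset.sum_congr rfl fun i _ => (pderiv_eventuallyEq (pderiv_eventuallyEq h i) i).eq_of_nhds

lemma dirac_eq_of_eventuallyEq {n : ℕ} {f g : (Fin (n + 1) → ℝ) → Cl n}
    {x : Fin (n + 1) → ℝ} (h : f =ᶠ[nhds x] g) : dirac f x = dirac g x := by
  simp only [dirac, (pderiv_eventuallyEq h _).eq_of_nhds]

lemma sum_sq_pos {x : Fin m → ℝ} (hx : x ≠ 0) : 0 < ∑ i, x i ^ 2 := by
  obtain ⟨i, hi : x i ≠ 0⟩ := Function.ne_iff.1 hx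
  exact Finset.sum_pos' (fun i _ => sq_nonneg _) ⟨i, Finset.mem_univ i, by positivity⟩

lemma enorm_pos {x : Fin m → ℝ} (hx : x ≠ 0) : 0 < enorm x :=
  Real.sqrt_pos.2 (sum_sq_pos hx)

lemma sq_enorm (x : Fin m → ℝ) : enorm x ^ 2 = ∑ i, x i ^ 2 :=
  Real.sq_sqrt (Finset.sum_nonneg fun _ _ => sq_nonneg _)

lemma hasFDerivAt_enorm_zpow {x : Fin m → ℝ} (hx : x ≠ 0) (p : ℤ) :
    HasFDerivAt (fun y : Fin m → ℝ => enorm y ^ p)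
      ((p * enorm x ^ (p - 2)) •
        ∑ i, x i • ContinuousLinearMap.proj (R := ℝ) (φ := fun _ : Fin m => ℝ) i) x := by
  have hq : HasFDerivAt (fun y : Fin m → ℝ => ∑ i, y i ^ 2)
      (∑ i, (2 * x i) • ContinuousLinearMap.proj (R := ℝ) (φ := fun _ : Fin m => ℝ) i) x := by
    refine HasFDerivAt.fun_sum fun i _ => ?_
    simpa using (hasFDerivAt_apply (𝕜 := ℝ) (F' := fun _ : Fin m => ℝ) i x).pow 2
  have hr := enorm_pos hx
  have h := (hasDerivAt_zpow p (enorm x) (Or.inl hr.ne')).comp_hasFDerivAt x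
    (hq.sqrt (sum_sq_pos hx).ne')
  refine h.congr_fderiv ?_
  rw [show √(∑ i, x i ^ 2) = enorm x from rfl]
  simp only [mul_smul, ← Finset.smul_sum]
  simp only [smul_smul]
  congr 1
  rw [zpow_sub₀ hr.ne', zpow_sub₀ hr.ne']
  field_simp

lemma pderiv_zpow_smul {x : Fin m → ℝ} (hx : x ≠ 0) (c : ℝ) (p : ℤ)
    (L : (Fin m → ℝ) →L[ℝ] E) (j : Fin m) :
    pderiv j (fun y => (c * enorm y ^ p) • L y) x =
      (c * p * enorm x ^ (p - 2)) • x j • L x + (c * enorm x ^ p) • L (Pi.single j 1) := by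
  rw [pderiv_eq_of_hasFDerivAt
    (((hasFDerivAt_enorm_zpow hx p).const_mul c).fun_smul L.hasFDerivAt)]
  simp [Pi.single_apply, add_comm, smul_smul, mul_assoc]

lemma pderiv_pderiv_zpow_smul {x : Fin m → ℝ} (hx : x ≠ 0) (c : ℝ) (p : ℤ)
    (L : (Fin m → ℝ) →L[ℝ] E) (j : Fin m) :
    pderiv j (pderiv j (fun y => (c * enorm y ^ p) • L y)) x =
      (c * p * (p - 2) * enorm x ^ (p - 4) * x j ^ 2 + c * p * enorm x ^ (p - 2)) • L x +
        (2 * c * p * enorm x ^ (p - 2)) • x j • L (Pi.single j 1) := by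
  have h : pderiv j (fun y => (c * enorm y ^ p) • L y) =ᶠ[nhds x] fun y =>
      (c * p * enorm y ^ (p - 2)) • y j • L y + (c * enorm y ^ p) • L (Pi.single j 1) :=
    (isOpen_ne.eventually_mem hx).mono fun y hy => pderiv_zpow_smul hy c p L j
  rw [(pderiv_eventuallyEq h j).eq_of_nhds]
  rw [pderiv_eq_of_hasFDerivAt ((((hasFDerivAt_enorm_zpow hx (p - 2)).const_mul (c * p)).fun_smul
    ((hasFDerivAt_apply (𝕜 := ℝ) (F' := fun _ : Fin m => ℝ) j x).fun_smul L.hasFDerivAt)).fun_add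
    (((hasFDerivAt_enorm_zpow hx p).const_mul c).smul_const (L (Pi.single j 1))))]
  simp [Pi.single_apply]
  rw [show p - 2 - 2 = p - 4 by ring]
  module

/-- The Laplacian multiplies `r ^ p • L x`, with `L` linear, by `p (p + m) / r²`. -/
lemma lap_zpow_smul {x : Fin m → ℝ} (hx : x ≠ 0) (c : ℝ) (p : ℤ)
    (L : (Fin m → ℝ) →L[ℝ] E) :
    lap (fun y => (c * enorm y ^ p) • L y) x =
      (c * p * (p + m) * enorm x ^ (p - 2)) • L x := by
  have hr := (enorm_pos hx).ne'
  have hL : ∑ j, x j • L (Pi.single j 1) = L x := by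
    conv_rhs => rw [pi_eq_sum_univ' x]
    simp [map_sum]
  simp only [lap, pderiv_pderiv_zpow_smul hx, Finset.sum_add_distrib, ← Finset.smul_sum, hL,
    ← Finset.sum_smul, ← Finset.mul_sum, ← sq_enorm]
  rw [← add_smul]
  congr 1
  have h4 : enorm x ^ (p - 2) = enorm x ^ (p - 4) * enorm x ^ 2 := by
    rw [← zpow_natCast, ← zpow_add₀ hr]
    congr 1
    push_cast
    ring
  simp [h4]
  ring

lemma exists_iterate_lap_zpow_smul (L : (Fin m → ℝ) →L[ℝ] E) (p : ℤ) (j : ℕ) :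
    ∃ c : ℝ, ∀ x : Fin m → ℝ, x ≠ 0 →
      lap^[j] (fun y => (enorm y ^ p) • L y) x = (c * enorm x ^ (p - 2 * j)) • L x := by
  induction j with
  | zero => exact ⟨1, by simp⟩
  | succ j ih =>
    obtain ⟨c, hc⟩ := ih
    refine ⟨c * (p - 2 * j : ℤ) * ((p - 2 * j : ℤ) + m), fun x hx => ?_⟩
    rw [Function.iterate_succ_apply', lap_eq_of_eventuallyEq
      ((isOpen_ne.eventually_mem hx).mono fun y hy => hc y hy), lap_zpow_smul hx]
    congr 3
    push_cast
    ring

end Calculus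

section Algebra

variable {n : ℕ}

/-- Clifford multiplication as a bilinear map. -/
def mulₗ (n : ℕ) : Cl n →ₗ[ℝ] Cl n →ₗ[ℝ] Cl n :=
  LinearMap.mk₂ ℝ mul
    (fun a b c => funext fun C => by
      change (∑ A, ∑ B, if A ∆ B = C then mulSign A B * (a A + b A) * c B else 0) =
        (∑ A, ∑ B, if A ∆ B = C then mulSign A B * a A * c B else 0) +
          ∑ A, ∑ B, if A ∆ B = C then mulSign A B * b A * c B else 0
      simp only [← Finset.sum_add_distrib]
      refine Finset.sum_congr rfl fun A _ => Finset.sum_congr rfl fun B _ => ?_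
      split_ifs <;> ring)
    (fun r a b => funext fun C => by
      change (∑ A, ∑ B, if A ∆ B = C then mulSign A B * (r * a A) * b B else 0) =
        r * ∑ A, ∑ B, if A ∆ B = C then mulSign A B * a A * b B else 0
      simp only [Finset.mul_sum]
      refine Finset.sum_congr rfl fun A _ => Finset.sum_congr rfl fun B _ => ?_
      split_ifs <;> ring)
    (fun a b c => funext fun C => by
      change (∑ A, ∑ B, if A ∆ B = C then mulSign A B * a A * (b B + c B) else 0) =
        (∑ A, ∑ B, if A ∆ B = C then mulSign A B * a A * b B else 0) +
          ∑ A, ∑ B, if A ∆ B = C then mulSign A B * a A * c B else 0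
      simp only [← Finset.sum_add_distrib]
      refine Finset.sum_congr rfl fun A _ => Finset.sum_congr rfl fun B _ => ?_
      split_ifs <;> ring)
    (fun r a b => funext fun C => by
      change (∑ A, ∑ B, if A ∆ B = C then mulSign A B * a A * (r * b B) else 0) =
        r * ∑ A, ∑ B, if A ∆ B = C then mulSign A B * a A * b B else 0
      simp only [Finset.mul_sum]
      refine Finset.sum_congr rfl fun A _ => Finset.sum_congr rfl fun B _ => ?_
      split_ifs <;> ring)

lemma mulₗ_apply (a b : Cl n) : mulₗ n a b = mul a b := rfl

lemma mul_single_single (A B : Finset (Fin n)) (r s : ℝ) :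
    mul (Pi.single A r : Cl n) (Pi.single B s : Cl n) =
      (Pi.single (A ∆ B) (mulSign A B * r * s) : Cl n) := by
  funext C
  simp only [mul]
  rw [Finset.sum_eq_single A, Finset.sum_eq_single B]
  · simp [Pi.single_apply, eq_comm]
  · intro B' _ h
    simp [Pi.single_eq_of_ne h]
  · simp
  · intro A' _ h
    simp [Pi.single_eq_of_ne h]
  · simp

protected lemma one_mul (a : Cl n) : mul one a = a := by
  funext C
  simp only [mul, one]
  rw [Finset.sum_eq_single ∅]
  · simp [← Finset.bot_eq_empty]
    simp [mulSign]
  · intro A' _ h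
    simp [Pi.single_eq_of_ne h]
  · simp

protected lemma mul_one (a : Cl n) : mul a one = a := by
  funext C
  simp only [mul, one]
  rw [Finset.sum_comm, Finset.sum_eq_single ∅]
  · simp [← Finset.bot_eq_empty]
    simp [mulSign]
  · intro A' _ h
    simp [Pi.single_eq_of_ne h]
  · simp

lemma mul_e_self (i : Fin n) : mul (e i) (e i) = -one := by
  rw [e, mul_single_single]
  funext C
  change _ = -(Pi.single ∅ 1 : Finset (Fin n) → ℝ) C
  simp [mulSign, Finset.filter_singleton, Pi.single_apply]
  split_ifs <;> simp

lemma mulSign_singleton {i j : Fin n} (h : i ≠ j) :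
    mulSign {i} {j} = -mulSign {j} {i} := by
  rcases lt_or_gt_of_ne h with h' | h' <;>
  simp [mulSign, Finset.filter_singleton, h, h.symm, h', h'.not_gt]

lemma mul_e_add_mul_e {i j : Fin n} (h : i ≠ j) :
    mul (e i) (e j) + mul (e j) (e i) = 0 := by
  rw [e, e, mul_single_single, mul_single_single]
  funext C
  change (Pi.single _ _ : Finset (Fin n) → ℝ) C + (Pi.single _ _ : Finset (Fin n) → ℝ) C = 0
  rw [symmDiff_comm ({j} : Finset (Fin n)) {i}, mulSign_singleton h]
  simp only [Pi.single_apply]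
  split_ifs <;> simp

/-- The Clifford units of the coordinate vectors of `ℝ^{n+1}`. -/
def unit : Fin (n + 1) → Cl n := Fin.cases one e

/-- The Clifford conjugates of the coordinate units. -/
def conjUnit : Fin (n + 1) → Cl n := Fin.cases one fun i => -e i

/-- The conjugate `conj x` of a paravector as a continuous linear map of its coordinates. -/
def conjParaL (n : ℕ) : (Fin (n + 1) → ℝ) →L[ℝ] Cl n :=
  ∑ j, (ContinuousLinearMap.proj (R := ℝ) (φ := fun _ : Fin (n + 1) => ℝ) j).smulRight
    (conjUnit j)

lemma conjParaL_apply (x : Fin (n + 1) → ℝ) : conjParaL n x = ∑ j, x j • conjUnit j := by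
  simp [conjParaL]

lemma conjParaL_single (j : Fin (n + 1)) : conjParaL n (Pi.single j 1) = conjUnit j := by
  simp [conjParaL_apply, Pi.single_apply]

lemma conj_para (x : Fin (n + 1) → ℝ) : conj (para x) = conjParaL n x := by
  let conjL : Cl n →ₗ[ℝ] Cl n :=
    { toFun := conj
      map_add' := fun a b => funext fun A => mul_add _ (a A) (b A)
      map_smul' := fun r a => funext fun A => mul_left_comm _ r (a A) }
  have hs (A : Finset (Fin n)) (r : ℝ) : conj (Pi.single A r : Cl n) =
      ((-1 : ℝ) ^ (A.card * (A.card + 1) / 2) * r) • (Pi.single A 1 : Cl n) := by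
    funext B
    change _ * (Pi.single A r : Finset (Fin n) → ℝ) B =
      _ * (Pi.single A 1 : Finset (Fin n) → ℝ) B
    by_cases h : B = A
    · subst h; simp
    · simp [Pi.single_eq_of_ne h]
  change conjL (para x) = _
  rw [para, map_add, map_sum, conjParaL_apply, Fin.sum_univ_succ]
  congr 1
  · change conj (Pi.single ∅ (x 0) : Cl n) = _
    rw [hs]
    simp [conjUnit, one]
    rfl
  · refine Finset.sum_congr rfl fun i _ => ?_
    rw [map_smul]
    congr 1
    change conj (Pi.single {i} 1 : Cl n) = - (Pi.single {i} 1 : Cl n)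
    rw [hs]
    simp
    rfl

lemma dirac_eq_sum (f : (Fin (n + 1) → ℝ) → Cl n) (x : Fin (n + 1) → ℝ) :
    dirac f x = ∑ j, mulₗ n (unit j) (pderiv j f x) := by
  rw [dirac, Fin.sum_univ_succ]
  simp [unit, mulₗ_apply, Cl.one_mul]

lemma mul_unit_conjUnit_self (i : Fin (n + 1)) : mulₗ n (unit i) (conjUnit i) = one := by
  cases i using Fin.cases with
  | zero => simp [unit, conjUnit, mulₗ_apply, Cl.one_mul]
  | succ i =>
    rw [unit, conjUnit, Fin.cases_succ, Fin.cases_succ, map_neg, mulₗ_apply, mul_e_self, neg_neg]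

lemma mul_unit_conjUnit_add {i j : Fin (n + 1)} (h : i ≠ j) :
    mulₗ n (unit i) (conjUnit j) + mulₗ n (unit j) (conjUnit i) = 0 := by
  cases i using Fin.cases with
  | zero =>
    cases j using Fin.cases with
    | zero => exact absurd rfl h
    | succ j => simp [unit, conjUnit, mulₗ_apply, Cl.one_mul, Cl.mul_one]
  | succ i =>
    cases j using Fin.cases with
    | zero => simp [unit, conjUnit, mulₗ_apply, Cl.one_mul, Cl.mul_one]
    | succ j =>
      have h' : i ≠ j := fun h' => h (congrArg _ h')
      simp only [unit, conjUnit, Fin.cases_succ, map_neg, mulₗ_apply]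
      rw [← neg_add, mul_e_add_mul_e h', neg_zero]

/-- The identity `x * conj x = ‖x‖²` for paravectors. -/
lemma sum_smul_mul_conjParaL (x : Fin (n + 1) → ℝ) :
    ∑ j, x j • mulₗ n (unit j) (conjParaL n x) = (enorm x ^ 2) • one := by
  set S := ∑ j, x j • mulₗ n (unit j) (conjParaL n x) with hS
  have h1 : S = ∑ i, ∑ j, (x i * x j) • mulₗ n (unit i) (conjUnit j) := by
    simp only [hS, conjParaL_apply, map_sum, map_smul, Finset.smul_sum, smul_smul]
  have h2 : S = ∑ i, ∑ j, (x i * x j) • mulₗ n (unit j) (conjUnit i) := by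
    rw [h1, Finset.sum_comm]
    simp only [mul_comm]
  have h3 : (2 : ℝ) • S = (2 : ℝ) • ((enorm x ^ 2) • one) := by
    rw [two_smul]
    nth_rewrite 1 [h1]
    rw [h2]
    simp only [← Finset.sum_add_distrib, ← smul_add]
    rw [sq_enorm, Finset.sum_smul, Finset.smul_sum]
    refine Finset.sum_congr rfl fun i _ => ?_
    rw [Finset.sum_eq_single i]
    · rw [mul_unit_conjUnit_self]
      module
    · intro j _ h
      rw [mul_unit_conjUnit_add h.symm, smul_zero]
    · simp
  exact smul_right_injective _ (two_ne_zero (α := ℝ)) h3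

lemma dirac_zpow_smul_conjParaL {x : Fin (n + 1) → ℝ} (hx : x ≠ 0) (c : ℝ) :
    dirac (fun y => (c * enorm y ^ (-(n + 1 : ℤ))) • conjParaL n y) x = 0 := by
  have hr := (enorm_pos hx).ne'
  simp only [dirac_eq_sum, pderiv_zpow_smul hx, conjParaL_single, map_add, map_smul,
    mul_unit_conjUnit_self, Finset.sum_add_distrib, ← Finset.smul_sum, sum_smul_mul_conjParaL]
  have h2 : enorm x ^ (-(n + 1 : ℤ)) = enorm x ^ (-(n + 1 : ℤ) - 2) * enorm x ^ 2 := by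
    rw [← zpow_natCast, ← zpow_add₀ hr]
    congr 1
  rw [h2]
  simp only [Finset.sum_const, Finset.card_univ, Fintype.card_fin]
  module

end Algebra

end Cl

/-- The kernel function `G_k(x) = conj(x)/‖x‖^{n+1-k}` is `k`-holomorphic Cliffordian on
`ℝ^{n+1} \ {0}`. -/
theorem kernel_function_is_kHolomorphicCliffordian
    (n : ℕ) (hn : 1 ≤ n) (k : ℕ) (hk : Even k)
    (G : (Fin (n + 1) → ℝ) → Cl n)
    (hG : G = fun x => (Cl.enorm x ^ ((n : ℤ) + 1 - (k : ℤ)))⁻¹ • Cl.conj (Cl.para x)) :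
    ∀ x : Fin (n + 1) → ℝ, x ≠ 0 → Cl.dirac ((Cl.lap)^[k / 2] G) x = 0 := by
  subst hG
  intro x hx
  have hfun : (fun y => (Cl.enorm y ^ ((n : ℤ) + 1 - (k : ℤ)))⁻¹ • Cl.conj (Cl.para y)) =
      fun y => (Cl.enorm y ^ ((k : ℤ) - (n + 1))) • Cl.conjParaL n y := by
    funext y
    rw [Cl.conj_para, ← zpow_neg, neg_sub]
  obtain ⟨c, hc⟩ := Cl.exists_iterate_lap_zpow_smul (Cl.conjParaL n) ((k : ℤ) - (n + 1)) (k / 2)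
  have hexp : (k : ℤ) - (n + 1) - 2 * ((k / 2 : ℕ) : ℤ) = -(n + 1 : ℤ) := by
    have := Nat.two_mul_div_two_of_even hk
    omega
  rw [hexp] at hc
  rw [hfun, Cl.dirac_eq_of_eventuallyEq
    ((isOpen_ne.eventually_mem hx).mono fun y hy => hc y hy), Cl.dirac_zpow_smul_conjParaL hx]
end
end

section
/- Let n ≥ 3 be odd. Consider the functions f₁(x) = x·e_n and f₂(x) = x + e_n on ℝ^{n+1}, where x = x_0 + x_1e_1 + ⋯ + x_ne_n denotes the paravector variable. Then f₁ and f₂ are (n−1)-holomorphic Cliffordian, i.e. D Δ^{(n−1)/2} f_j = 0 on ℝ^{n+1} for j = 1, 2, but neither f₁ nor f₂ is (n−1)-hypermonogenic on H⁺: for j = 1, 2 there exists x ∈ H⁺ with Df_j(x) + (n−1)(Qf_j(x))′/x_n ≠ 0. -/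
noncomputable section

open scoped symmDiff

namespace Cl

/-- The basis element `e_A`, scaled by `r`. -/
def blade {n : ℕ} (A : Finset (Fin n)) (r : ℝ) : Cl n := Pi.single A r

lemma blade_apply {n : ℕ} (A B : Finset (Fin n)) (r : ℝ) :
    blade A r B = if B = A then r else 0 := by
  simp [blade, Pi.single_apply]

lemma add_apply {n : ℕ} (a b : Cl n) (A : Finset (Fin n)) : (a + b) A = a A + b A := rfl

lemma smul_apply {n : ℕ} (r : ℝ) (a : Cl n) (A : Finset (Fin n)) : (r • a) A = r * a A := rfl

lemma zero_apply {n : ℕ} (A : Finset (Fin n)) : (0 : Cl n) A = 0 := rfl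

lemma sum_apply {n : ℕ} {ι : Type*} (s : Finset ι) (a : ι → Cl n) (A : Finset (Fin n)) :
    (∑ i ∈ s, a i) A = ∑ i ∈ s, a i A :=
  Finset.sum_apply (M := fun _ : Finset (Fin n) => ℝ) A s a

lemma mul_blade_blade {n : ℕ} (A B : Finset (Fin n)) (r s : ℝ) :
    mul (blade A r) (blade B s) = blade (A ∆ B) (mulSign A B * r * s) := by
  funext C
  simp only [mul, blade_apply]
  rw [Finset.sum_eq_single A, Finset.sum_eq_single B]
  · simp [eq_comm]
  · intro D _ hD
    simp [hD]
  · simp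
  · intro D _ hD
    simp [hD]
  · simp

lemma mul_add_left {n : ℕ} (a b c : Cl n) : mul (a + b) c = mul a c + mul b c := by
  funext C
  simp only [mul, add_apply, ← Finset.sum_add_distrib]
  refine Finset.sum_congr rfl fun A _ => Finset.sum_congr rfl fun B _ => ?_
  split_ifs <;> ring

lemma mul_smul_left {n : ℕ} (r : ℝ) (a c : Cl n) : mul (r • a) c = r • mul a c := by
  funext C
  simp only [mul, smul_apply, Finset.mul_sum]
  refine Finset.sum_congr rfl fun A _ => Finset.sum_congr rfl fun B _ => ?_
  split_ifs <;> ring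

lemma mul_zero_right {n : ℕ} (a : Cl n) : mul a 0 = 0 := by
  funext C
  simp [mul, zero_apply]

/-- Right multiplication by a fixed Clifford number, as a linear map. -/
def mulRight {n : ℕ} (c : Cl n) : Cl n →ₗ[ℝ] Cl n where
  toFun a := mul a c
  map_add' a b := mul_add_left a b c
  map_smul' r a := mul_smul_left r a c

lemma scalar_eq_smul {n : ℕ} (r : ℝ) : (scalar r : Cl n) = r • blade ∅ 1 := by
  funext A
  change blade ∅ r A = _
  simp [smul_apply, blade_apply]

/-- The paravector embedding, as a linear map. -/
def paraLinear (n : ℕ) : (Fin (n + 1) → ℝ) →ₗ[ℝ] Cl n where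
  toFun x := para x
  map_add' x y := by
    simp only [para, scalar_eq_smul, Pi.add_apply, add_smul, Finset.sum_add_distrib]
    abel
  map_smul' r x := by
    simp [para, scalar_eq_smul, mul_smul, Finset.smul_sum]

lemma para_single_zero (n : ℕ) : para (Pi.single 0 1 : Fin (n + 1) → ℝ) = blade ∅ 1 := by
  simp [para, scalar_eq_smul]

lemma para_single_succ {n : ℕ} (i : Fin n) :
    para (Pi.single i.succ 1 : Fin (n + 1) → ℝ) = blade {i} 1 := by
  simp [para, scalar_eq_smul, Pi.single_apply, (Fin.succ_ne_zero i).symm]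
  rfl

lemma pderiv_affine {n : ℕ} (L : (Fin (n + 1) → ℝ) →ₗ[ℝ] Cl n) (c : Cl n) (i : Fin (n + 1)) :
    pderiv i (fun x => L x + c) = fun _ => L (Pi.single i 1) := by
  funext x
  have h : HasFDerivAt (fun x => L x + c) (LinearMap.toContinuousLinearMap L) x :=
    (LinearMap.toContinuousLinearMap L).hasFDerivAt.add_const c
  rw [pderiv, h.fderiv]
  rfl

lemma lap_affine {n : ℕ} (L : (Fin (n + 1) → ℝ) →ₗ[ℝ] Cl n) (c : Cl n) :
    lap (fun x => L x + c) = 0 := by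
  funext x
  simp only [lap, pderiv_affine]
  simp [pderiv]

lemma dirac_iterate_lap_affine {n : ℕ} (L : (Fin (n + 1) → ℝ) →ₗ[ℝ] Cl n) (c : Cl n) (k : ℕ)
    (x : Fin (n + 1) → ℝ) : dirac (lap^[k + 1] (fun x => L x + c)) x = 0 := by
  have h0 : lap (0 : (Fin (n + 1) → ℝ) → Cl n) = 0 := by
    simpa using! lap_affine (0 : (Fin (n + 1) → ℝ) →ₗ[ℝ] Cl n) 0
  rw [Function.iterate_succ_apply, lap_affine, Function.iterate_fixed h0]
  simp [dirac, pderiv, mul_zero_right]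

lemma mulSign_singleton_self {n : ℕ} (i : Fin n) : mulSign {i} {i} = -1 := by
  simp [mulSign, Finset.filter_singleton]

lemma mulSign_empty_right {n : ℕ} (A : Finset (Fin n)) : mulSign A ∅ = 1 := by
  simp [mulSign]

lemma mulSign_empty_left {n : ℕ} (A : Finset (Fin n)) : mulSign ∅ A = 1 := by
  simp [mulSign]

lemma mul_e_mul_e_last {n : ℕ} (i : Fin (n + 1)) :
    mul (blade {i} 1) (mul (blade {i} 1) (blade {Fin.last n} 1)) = blade {Fin.last n} (-1) := by
  rw [mul_blade_blade, mul_blade_blade, symmDiff_symmDiff_cancel_left]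
  congr 1
  rcases eq_or_ne i (Fin.last n) with rfl | hi
  · simp [mulSign_singleton_self, symmDiff_self, mulSign_empty_right]
  · have hlt : i < Fin.last n := Fin.lt_last_iff_ne_last.mpr hi
    have hd : ({i} : Finset (Fin (n + 1))) ∆ {Fin.last n} = {i, Fin.last n} := by
      ext j
      simp only [Finset.mem_symmDiff, Finset.mem_singleton, Finset.mem_insert]
      grind
    have h1 : mulSign {i} {Fin.last n} = 1 := by
      simp [mulSign, Finset.filter_singleton, hlt.not_gt, hi]
    have h2 : mulSign {i} {i, Fin.last n} = -1 := by
      have hf : (({i} ×ˢ {i, Fin.last n} : Finset (Fin (n + 1) × Fin (n + 1))).filter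
          fun p => p.2 < p.1) = ∅ := by
        ext ⟨a, b⟩
        simp only [Finset.mem_filter, Finset.mem_product, Finset.mem_singleton,
          Finset.mem_insert, Finset.notMem_empty, iff_false]
        grind
      rw [mulSign, hf, Finset.inter_eq_left.mpr (by simp)]
      simp
    rw [hd, h1, h2]
    norm_num

lemma dirac_para_add {n : ℕ} (c : Cl n) (x : Fin (n + 1) → ℝ) :
    dirac (fun x => para x + c) x = blade ∅ (1 - n) := by
  have h : ∀ i, pderiv i (fun x => para x + c) = fun _ => para (Pi.single i 1) :=
    pderiv_affine (paraLinear n) c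
  simp only [dirac, h, para_single_zero, para_single_succ]
  have he : ∀ i : Fin n, mul (e i) (blade {i} 1) = blade ∅ (-1) := fun i => by
    change mul (blade {i} 1) (blade {i} 1) = _
    rw [mul_blade_blade, symmDiff_self, mulSign_singleton_self]
    simp
  funext A
  simp only [he, add_apply, sum_apply, blade_apply]
  split_ifs <;> simp [sub_eq_add_neg]

lemma dirac_para_mul_e_last {n : ℕ} (x : Fin (n + 2) → ℝ) :
    dirac (fun x => mul (para x) (e (Fin.last n))) x = blade {Fin.last n} (-n) := by
  have h : ∀ i, pderiv i (fun x => mul (para x) (e (Fin.last n))) =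
      fun _ => mul (para (Pi.single i 1)) (e (Fin.last n)) := fun i => by
    simpa using! pderiv_affine (mulRight (e (Fin.last n)) ∘ₗ paraLinear (n + 1)) 0 i
  simp only [dirac, h, para_single_zero, para_single_succ]
  have he : ∀ i : Fin (n + 1), mul (e i) (mul (blade {i} 1) (e (Fin.last n))) =
    blade {Fin.last n} (-1) := mul_e_mul_e_last
  have h0 : mul (blade ∅ 1) (e (Fin.last n)) = blade {Fin.last n} 1 := by
    change mul (blade ∅ 1) (blade {Fin.last n} 1) = _
    rw [mul_blade_blade, mulSign_empty_left, ← Finset.bot_eq_empty, bot_symmDiff]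
    norm_num
  funext A
  simp only [he, h0, add_apply, sum_apply, blade_apply]
  split_ifs <;> simp

lemma para_apply_last {n : ℕ} (x : Fin (n + 2) → ℝ) :
    (para x : Cl (n + 1)) {Fin.last n} = x (Fin.last (n + 1)) := by
  have he : ∀ i : Fin (n + 1), (e i : Cl (n + 1)) {Fin.last n} =
      if Fin.last n = i then 1 else 0 := fun i => by
    change blade {i} 1 {Fin.last n} = _
    simp [blade_apply]
  simp [para, scalar_eq_smul, add_apply, sum_apply, smul_apply, he, blade_apply]

end Cl

/-- For odd `n = 2m + 3 ≥ 3`, the functions `f₁(x) = x eₙ` and `f₂(x) = x + eₙ` are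
`(n-1)`-holomorphic Cliffordian on `ℝ^{n+1}` but not `(n-1)`-hypermonogenic on `H⁺`. -/
theorem xen_and_x_plus_en_not_hypermonogenic
    (m : ℕ)
    (f₁ f₂ : (Fin (2 * m + 4) → ℝ) → Cl (2 * m + 3))
    (h1 : f₁ = fun x => Cl.mul (Cl.para x) (Cl.e (Fin.last (2 * m + 2))))
    (h2 : f₂ = fun x => Cl.para x + Cl.e (Fin.last (2 * m + 2))) :
    (∀ x, Cl.dirac ((Cl.lap)^[(2 * m + 3 - 1) / 2] f₁) x = 0) ∧
      (∀ x, Cl.dirac ((Cl.lap)^[(2 * m + 3 - 1) / 2] f₂) x = 0) ∧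
      (∃ x ∈ Cl.upperHalf (2 * m + 3),
        Cl.dirac f₁ x + (((2 * m + 3 : ℝ) - 1) / x (Fin.last (2 * m + 3))) •
          Cl.involute (Cl.Qpart (f₁ x)) ≠ 0) ∧
      (∃ x ∈ Cl.upperHalf (2 * m + 3),
        Cl.dirac f₂ x + (((2 * m + 3 : ℝ) - 1) / x (Fin.last (2 * m + 3))) •
          Cl.involute (Cl.Qpart (f₂ x)) ≠ 0) := by
  have hk : (2 * m + 3 - 1) / 2 = m + 1 := by omega
  have hm : (0 : ℝ) ≤ m := Nat.cast_nonneg m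
  rw [hk, h1, h2]
  refine ⟨fun x => ?_, fun x => ?_, ⟨fun _ => 1, one_pos (α := ℝ), fun h => ?_⟩,
    ⟨fun _ => 1, one_pos (α := ℝ), fun h => ?_⟩⟩
  · simpa using! Cl.dirac_iterate_lap_affine
      (Cl.mulRight (Cl.e (Fin.last (2 * m + 2))) ∘ₗ Cl.paraLinear (2 * m + 3)) 0 m x
  · exact Cl.dirac_iterate_lap_affine (Cl.paraLinear (2 * m + 3))
      (Cl.e (Fin.last (2 * m + 2))) m x
  · rw [Cl.dirac_para_mul_e_last] at h
    have := congrFun h {Fin.last (2 * m + 2)}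
    simp [Cl.add_apply, Cl.smul_apply, Cl.zero_apply, Cl.blade_apply, Cl.involute,
      Cl.Qpart] at this
    linarith
  · rw [Cl.dirac_para_add] at h
    have := congrFun h ∅
    have he : Cl.e (Fin.last (2 * m + 2)) {Fin.last (2 * m + 2)} = 1 := by
      change Cl.blade _ 1 _ = _
      simp [Cl.blade_apply]
    simp [Cl.add_apply, Cl.smul_apply, Cl.zero_apply, Cl.blade_apply, Cl.involute,
      Cl.Qpart, Cl.para_apply_last, he] at this
    linarith
end
end

section
/- Let n ≥ 1, k ∈ ℝ, ω = (ω_0,…,ω_{n−1}) ∈ ℝ^n, and let h : (0,∞) → ℂ be smooth. Define u : H⁺ → ℂ by u(x) = exp(2πi(ω_0x_0 + ⋯ + ω_{n−1}x_{n−1})) · h(x_n). Then: (a) u satisfies the homogeneous Weinstein equation Δu − (k/x_n) ∂u/∂x_n = 0 on H⁺ if and only if h''(t) = 4π²‖ω‖² h(t) + (k/t) h'(t) for all t > 0; and (b) u satisfies the inhomogeneous Weinstein equation Δu − (k/x_n) ∂u/∂x_n = −(k/x_n²) u on H⁺ if and only if h''(t) = 4π²‖ω‖² h(t) + (k/t)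 h'(t) − (k/t²) h(t) for all t > 0. -/
noncomputable section

open scoped symmDiff

/-- The plane wave `exp(2πi⟨ω, x̲⟩)` in the first `n` coordinates of `x ∈ ℝ^{n+1}`. -/
def planeWave {n : ℕ} (ω : Fin n → ℝ) (x : Fin (n + 1) → ℝ) : ℂ :=
  Complex.exp (2 * (Real.pi : ℂ) * Complex.I *
    (∑ j : Fin n, (ω j : ℂ) * (x j.castSucc : ℂ)))

/-- The product of a plane wave with a function of the last coordinate. -/
def separated {n : ℕ} (ω : Fin n → ℝ) (g : ℝ → ℂ) (x : Fin (n + 1) → ℝ) : ℂ :=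
  planeWave ω x * g (x (Fin.last n))

section

variable {n : ℕ} {ω : Fin n → ℝ} {g g₁ g₂ : ℝ → ℂ} {x : Fin (n + 1) → ℝ} {a : ℂ}

theorem hasFDerivAt_planeWave (ω : Fin n → ℝ) (x : Fin (n + 1) → ℝ) :
    HasFDerivAt (planeWave ω)
      (planeWave ω x • (2 * (Real.pi : ℂ) * Complex.I) •
        ∑ j : Fin n, (ω j : ℂ) • Complex.ofRealCLM.comp
          (ContinuousLinearMap.proj (R := ℝ) (φ := fun _ : Fin (n + 1) => ℝ) j.castSucc)) x := by
  refine HasFDerivAt.cexp (HasFDerivAt.const_mul (HasFDerivAt.fun_sum fun j _ => ?_) _)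
  exact (Complex.ofRealCLM.comp (ContinuousLinearMap.proj (R := ℝ)
    (φ := fun _ : Fin (n + 1) => ℝ) j.castSucc)).hasFDerivAt.const_mul _

theorem hasFDerivAt_separated (hg : HasDerivAt g a (x (Fin.last n))) :
    HasFDerivAt (separated ω g)
      (planeWave ω x • (ContinuousLinearMap.proj (R := ℝ)
          (φ := fun _ : Fin (n + 1) => ℝ) (Fin.last n)).smulRight a +
        g (x (Fin.last n)) • planeWave ω x • (2 * (Real.pi : ℂ) * Complex.I) •
          ∑ j : Fin n, (ω j : ℂ) • Complex.ofRealCLM.comp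
            (ContinuousLinearMap.proj (R := ℝ) (φ := fun _ : Fin (n + 1) => ℝ) j.castSucc))
      x := by
  have hl : HasFDerivAt (fun y : Fin (n + 1) → ℝ => y (Fin.last n))
      (ContinuousLinearMap.proj (R := ℝ) (φ := fun _ : Fin (n + 1) => ℝ) (Fin.last n)) x :=
    hasFDerivAt_apply (Fin.last n) x
  have hgl := hg.hasFDerivAt.comp x hl
  refine ((hasFDerivAt_planeWave ω x).mul hgl).congr_fderiv ?_
  ext v
  simp

theorem pderiv_last_separated (hg : HasDerivAt g a (x (Fin.last n))) :
    Cl.pderiv (Fin.last n) (separated ω g) x = planeWave ω x * a := by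
  simp [Cl.pderiv, (hasFDerivAt_separated hg).fderiv, Fin.castSucc_ne_last]

theorem pderiv_castSucc_separated (i : Fin n) (hg : HasDerivAt g a (x (Fin.last n))) :
    Cl.pderiv i.castSucc (separated ω g) x =
      2 * Real.pi * Complex.I * ω i * separated ω g x := by
  simp [Cl.pderiv, (hasFDerivAt_separated hg).fderiv, Pi.single_apply, separated,
    (Fin.castSucc_ne_last _).symm, apply_ite Complex.ofReal]
  ring

theorem pderiv_congr {m : ℕ} {f₁ f₂ : (Fin m → ℝ) → ℂ} {y : Fin m → ℝ} (i : Fin m)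
    (hf : f₁ =ᶠ[nhds y] f₂) : Cl.pderiv i f₁ y = Cl.pderiv i f₂ y := by
  simp only [Cl.pderiv, hf.fderiv_eq]

theorem eventually_last_pos (hx : 0 < x (Fin.last n)) :
    ∀ᶠ y : Fin (n + 1) → ℝ in nhds x, 0 < y (Fin.last n) :=
  (continuous_apply (Fin.last n)).continuousAt.eventually (lt_mem_nhds hx)

theorem enorm_sq {m : ℕ} (v : Fin m → ℝ) : Cl.enorm v ^ 2 = ∑ i, v i ^ 2 :=
  Real.sq_sqrt (Finset.sum_nonneg fun i _ => sq_nonneg (v i))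

theorem lap_separated (h₁ : ∀ t, 0 < t → HasDerivAt g (g₁ t) t)
    (h₂ : ∀ t, 0 < t → HasDerivAt g₁ (g₂ t) t) (hx : 0 < x (Fin.last n)) :
    Cl.lap (separated ω g) x = planeWave ω x *
      (g₂ (x (Fin.last n)) -
        4 * (Real.pi : ℂ) ^ 2 * ((Cl.enorm ω : ℝ) : ℂ) ^ 2 * g (x (Fin.last n))) := by
  have hlast : Cl.pderiv (Fin.last n) (Cl.pderiv (Fin.last n) (separated ω g)) x =
      planeWave ω x * g₂ (x (Fin.last n)) := by
    rw [← pderiv_last_separated (h₂ _ hx)]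
    refine pderiv_congr _ ?_
    filter_upwards [eventually_last_pos hx] with y hy
    exact pderiv_last_separated (h₁ _ hy)
  have hcast (i : Fin n) : Cl.pderiv i.castSucc (Cl.pderiv i.castSucc (separated ω g)) x =
      -(4 * (Real.pi : ℂ) ^ 2 * separated ω g x) * (ω i : ℂ) ^ 2 := by
    have hc : Cl.pderiv i.castSucc (separated ω g) =ᶠ[nhds x]
        separated ω fun t => 2 * Real.pi * Complex.I * ω i * g t := by
      filter_upwards [eventually_last_pos hx] with y hy
      rw [pderiv_castSucc_separated i (h₁ _ hy), separated, separated]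
      ring
    rw [pderiv_congr _ hc, pderiv_castSucc_separated i ((h₁ _ hx).const_mul _),
      separated, separated]
    linear_combination 4 * (Real.pi : ℂ) ^ 2 * (ω i : ℂ) ^ 2 * planeWave ω x *
      g (x (Fin.last n)) * Complex.I_sq
  have hω : ((Cl.enorm ω : ℝ) : ℂ) ^ 2 = ∑ i, (ω i : ℂ) ^ 2 := by
    exact_mod_cast congrArg (fun r : ℝ => (r : ℂ)) (enorm_sq ω)
  rw [Cl.lap, Fin.sum_univ_castSucc, hlast, Finset.sum_congr rfl fun i _ => hcast i,
    ← Finset.mul_sum, ← hω, separated]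
  ring

/-- A condition on `H⁺` that only involves the last coordinate is a condition on `(0,∞)`. -/
theorem forall_upperHalf_iff {P : (Fin (n + 1) → ℝ) → Prop} {Q : ℝ → Prop}
    (hPQ : ∀ x, 0 < x (Fin.last n) → (P x ↔ Q (x (Fin.last n)))) :
    (∀ x ∈ Cl.upperHalf n, P x) ↔ ∀ t, 0 < t → Q t :=
  ⟨fun hP t ht => (hPQ (fun _ => t) ht).1 (hP _ ht), fun hQ x hx => (hPQ x hx).2 (hQ _ hx)⟩

end

/-- Separation of variables for the Weinstein equations: for
`u(x) = exp(2πi⟨ω, x̲⟩) h(xₙ)`, the homogeneous (resp. inhomogeneous) Weinstein equation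
for `u` on `H⁺` is equivalent to the ODE `h'' = 4π²‖ω‖² h + (k/t) h'`
(resp. `h'' = 4π²‖ω‖² h + (k/t) h' - (k/t²) h`) on `(0,∞)`. -/
theorem weinstein_fourier_separation
    (n : ℕ) (hn : 1 ≤ n) (k : ℝ) (ω : Fin n → ℝ)
    (h : ℝ → ℂ) (hh : ContDiffOn ℝ (⊤ : ℕ∞) h (Set.Ioi (0 : ℝ)))
    (u : (Fin (n + 1) → ℝ) → ℂ)
    (hu : u = fun x => Complex.exp (2 * (Real.pi : ℂ) * Complex.I *
        (∑ j : Fin n, (ω j : ℂ) * (x j.castSucc : ℂ))) * h (x (Fin.last n))) :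
    ((∀ x ∈ Cl.upperHalf n,
        Cl.lap u x - ((k : ℂ) / (x (Fin.last n) : ℂ)) *
          Cl.pderiv (Fin.last n) u x = 0) ↔
      (∀ t : ℝ, 0 < t →
        deriv (deriv h) t =
          4 * (Real.pi : ℂ) ^ 2 * ((Cl.enorm ω : ℝ) : ℂ) ^ 2 * h t +
            ((k : ℂ) / (t : ℂ)) * deriv h t)) ∧
    ((∀ x ∈ Cl.upperHalf n,
        Cl.lap u x - ((k : ℂ) / (x (Fin.last n) : ℂ)) *
          Cl.pderiv (Fin.last n) u x =
            -(((k : ℂ) / (x (Fin.last n) : ℂ) ^ 2) * u x)) ↔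
      (∀ t : ℝ, 0 < t →
        deriv (deriv h) t =
          4 * (Real.pi : ℂ) ^ 2 * ((Cl.enorm ω : ℝ) : ℂ) ^ 2 * h t +
            ((k : ℂ) / (t : ℂ)) * deriv h t - ((k : ℂ) / (t : ℂ) ^ 2) * h t)) := by
  have hd : ContDiffOn ℝ 1 (deriv h) (Set.Ioi 0) :=
    ((contDiffOn_succ_iff_deriv_of_isOpen (n := 1) isOpen_Ioi).1
      (hh.of_le (WithTop.coe_le_coe.2 (le_top : (1 + 1 : ℕ∞) ≤ ⊤)))).2.2
  have h₁ (t : ℝ) (ht : 0 < t) : HasDerivAt h (deriv h t) t :=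
    ((hh.differentiableOn (by simp)).differentiableAt (Ioi_mem_nhds ht)).hasDerivAt
  have h₂ (t : ℝ) (ht : 0 < t) : HasDerivAt (deriv h) (deriv (deriv h) t) t :=
    ((hd.differentiableOn (by simp)).differentiableAt (Ioi_mem_nhds ht)).hasDerivAt
  obtain rfl : u = separated ω h := hu
  refine ⟨forall_upperHalf_iff fun x hx => ?_, forall_upperHalf_iff fun x hx => ?_⟩ <;>
    rw [lap_separated h₁ h₂ hx, pderiv_last_separated (h₁ _ hx)] <;>
    have hE : planeWave ω x ≠ 0 := Complex.exp_ne_zero _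
  · constructor <;> intro H
    · refine mul_left_cancel₀ hE ?_
      linear_combination H
    · linear_combination planeWave ω x * H
  · rw [separated]
    constructor <;> intro H
    · refine mul_left_cancel₀ hE ?_
      linear_combination H
    · linear_combination planeWave ω x * H
end
end
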